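/- Let S ⊆ Fin n with |S| ≥ 2 and let f = Π_{i ∈ S} x_i ∈ ℂ[x₁,…,xₙ]. Then the Jacobian ideal J_f = ⟨∂f/∂x₁,…,∂f/∂xₙ⟩, which equals the ideal generated by the squarefree monomials Π_{j ∈ S, j ≠ i} x_j for i ∈ S, is a radical ideal of height 2. -/

import Mathlib

open MvPolynomial

/-- The Jacobian ideal `J_f = ⟨∂f/∂x₁, …, ∂f/∂xₙ⟩`. -/
noncomputable def jacobianIdeal {n : ℕ} (f : MvPolynomial (Fin n) ℂ) :
    Ideal (MvPolynomial (Fin n) ℂ) :=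
  Ideal.span (Set.range fun i => pderiv i f)

/-- The height of an ideal: the infimum of the heights of primes containing it. -/
noncomputable def idealHeight {R : Type*} [CommRing R] (I : Ideal R) : ℕ∞ :=
  sInf {h : ℕ∞ | ∃ p : PrimeSpectrum R, I ≤ p.asIdeal ∧ Order.height p = h}

lemma aux_isPrime {n : ℕ} (T : Set (Fin n)) :
    (Ideal.span (X '' T : Set (MvPolynomial (Fin n) ℂ))).IsPrime := by
  classical
  set I := Ideal.span (X '' T : Set (MvPolynomial (Fin n) ℂ)) with hI
  let φ : MvPolynomial (Fin n) ℂ →ₐ[ℂ] MvPolynomial (Fin n) ℂ :=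
    aeval (fun i => if i ∈ T then 0 else X i)
  have h1 : (Ideal.Quotient.mkₐ ℂ I).comp φ = Ideal.Quotient.mkₐ ℂ I := by
    apply MvPolynomial.algHom_ext
    intro i
    by_cases hi : i ∈ T
    · have : (X i : MvPolynomial (Fin n) ℂ) ∈ I := Ideal.subset_span ⟨i, hi, rfl⟩
      have h2 := Ideal.Quotient.eq_zero_iff_mem.mpr this
      simp [φ, hi, h2]
    · simp [φ, hi]
  have h2 : I = RingHom.ker φ.toRingHom := by
    apply le_antisymm
    · rw [hI, Ideal.span_le]
      rintro _ ⟨i, hi, rfl⟩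
      simp [RingHom.mem_ker, φ, hi]
    · intro x hx
      have hx : φ x = 0 := hx
      have h3 := DFunLike.congr_fun h1 x
      simp only [AlgHom.comp_apply, hx, map_zero] at h3
      exact Ideal.Quotient.eq_zero_iff_mem.mp h3.symm
  rw [h2]
  exact RingHom.ker_isPrime _

lemma aux_pderiv_prod {n : ℕ} (T : Finset (Fin n)) (i : Fin n) (hi : i ∉ T) :
    pderiv i (∏ j ∈ T, X j : MvPolynomial (Fin n) ℂ) = 0 := by
  classical
  induction T using Finset.induction_on with
  | empty => simp
  | insert a s ha ih =>
    simp only [Finset.mem_insert, not_or] at hi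
    rw [Finset.prod_insert ha, Derivation.leibniz, ih hi.2, pderiv_X_of_ne (Ne.symm hi.1)]
    simp

lemma aux_prod_monomial {n : ℕ} (T : Finset (Fin n)) :
    (∏ j ∈ T, X j : MvPolynomial (Fin n) ℂ) = monomial (∑ j ∈ T, Finsupp.single j 1) 1 := by
  rw [monomial_sum_one]
  rfl

lemma aux_jac {n : ℕ} (S : Finset (Fin n)) :
    jacobianIdeal (∏ i ∈ S, X i) = Ideal.span {g | ∃ i ∈ S, g = ∏ j ∈ S.erase i, X j} := by
  have key : ∀ i ∈ S, pderiv i (∏ i ∈ S, X i : MvPolynomial (Fin n) ℂ)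
      = ∏ j ∈ S.erase i, X j := by
    intro i hi
    rw [← Finset.mul_prod_erase S _ hi, Derivation.leibniz,
      aux_pderiv_prod _ _ (Finset.notMem_erase i S), pderiv_X_self]
    simp
  apply le_antisymm
  · rw [jacobianIdeal, Ideal.span_le]
    rintro _ ⟨i, rfl⟩
    by_cases hi : i ∈ S
    · exact Ideal.subset_span ⟨i, hi, key i hi⟩
    · simp [aux_pderiv_prod S i hi]
  · rw [jacobianIdeal, Ideal.span_le]
    rintro _ ⟨i, hi, rfl⟩
    exact Ideal.subset_span ⟨i, key i hi⟩

lemma aux_le {n : ℕ} (S : Finset (Fin n)) {i j : Fin n} (hi : i ∈ S) (hj : j ∈ S) (hij : i ≠ j) :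
    Ideal.span {g | ∃ i ∈ S, g = ∏ j ∈ S.erase i, X j} ≤
      Ideal.span (X '' {i, j} : Set (MvPolynomial (Fin n) ℂ)) := by
  rw [Ideal.span_le]
  rintro _ ⟨l, hl, rfl⟩
  have : ∃ k ∈ ({i, j} : Set (Fin n)), k ∈ S.erase l := by
    by_cases h : i = l
    · exact ⟨j, by simp, by simp [hj, ← h, hij.symm]⟩
    · exact ⟨i, by simp, by simp [hi, h]⟩
  obtain ⟨k, hk, hkS⟩ := this
  exact Ideal.mem_of_dvd _ (Finset.dvd_prod_of_mem X hkS) (Ideal.subset_span ⟨k, hk, rfl⟩)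

lemma aux_mem {n : ℕ} (S : Finset (Fin n)) (hS : 2 ≤ S.card) (x : MvPolynomial (Fin n) ℂ)
    (hx : ∀ i ∈ S, ∀ j ∈ S, i ≠ j →
      x ∈ Ideal.span (X '' {i, j} : Set (MvPolynomial (Fin n) ℂ))) :
    x ∈ Ideal.span {g : MvPolynomial (Fin n) ℂ | ∃ i ∈ S, g = ∏ j ∈ S.erase i, X j} := by
  classical
  have : {g : MvPolynomial (Fin n) ℂ | ∃ i ∈ S, g = ∏ j ∈ S.erase i, X j} =
      (fun s => monomial s (1 : ℂ)) ''
        ((fun i => ∑ j ∈ S.erase i, Finsupp.single j 1) '' (S : Set (Fin n))) := by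
    ext g
    simp [aux_prod_monomial, eq_comm]
  rw [this, mem_ideal_span_monomial_image]
  intro m hm
  have h1 : ∃ l ∈ S, ∀ j ∈ S, j ≠ l → m j ≠ 0 := by
    by_cases h : ∃ l ∈ S, m l = 0
    · obtain ⟨l, hl, h0⟩ := h
      refine ⟨l, hl, fun j hj hjl => ?_⟩
      obtain ⟨k, hk, hk0⟩ := mem_ideal_span_X_image.mp (hx j hj l hl hjl) m hm
      rcases hk with rfl | hk
      · exact hk0
      · rw [Set.mem_singleton_iff] at hk
        exact absurd (hk ▸ h0) hk0
    · push Not at h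
      obtain ⟨l, hl⟩ := Finset.card_pos.mp (by omega : 0 < S.card)
      exact ⟨l, hl, fun j hj _ => h j hj⟩
  obtain ⟨l, hl, h⟩ := h1
  refine ⟨_, ⟨l, hl, rfl⟩, fun k => ?_⟩
  simp only [Finsupp.finsetSum_apply, Finsupp.single_apply, Finset.sum_ite_eq']
  split_ifs with hk
  · rw [Finset.mem_erase] at hk
    exact Nat.one_le_iff_ne_zero.mpr (h k hk.2 hk.1)
  · exact Nat.zero_le _

lemma aux_two_le {n : ℕ} (S : Finset (Fin n)) (hS : 2 ≤ S.card)
    (p : Ideal (MvPolynomial (Fin n) ℂ)) [hp : p.IsPrime]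
    (h : Ideal.span {g : MvPolynomial (Fin n) ℂ | ∃ i ∈ S, g = ∏ j ∈ S.erase i, X j} ≤ p) :
    2 ≤ p.height := by
  have step : ∀ i ∈ S, ∃ j ∈ S, j ≠ i ∧ (X j : MvPolynomial (Fin n) ℂ) ∈ p := by
    intro i hi
    have h1 := h (Ideal.subset_span ⟨i, hi, rfl⟩)
    obtain ⟨j, hj, hjp⟩ := (Ideal.IsPrime.prod_mem_iff).mp h1
    rw [Finset.mem_erase] at hj
    exact ⟨j, hj.2, hj.1, hjp⟩
  obtain ⟨l, hl⟩ := Finset.card_pos.mp (by omega : 0 < S.card)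
  obtain ⟨j, hj, -, hjp⟩ := step l hl
  obtain ⟨k, hk, hkj, hkp⟩ := step j hj
  have hq : (Ideal.span {(X j : MvPolynomial (Fin n) ℂ)}).IsPrime :=
    (Ideal.span_singleton_prime (X_ne_zero j)).mpr X_prime
  have hlt1 : (⊥ : Ideal (MvPolynomial (Fin n) ℂ)) < Ideal.span {X j} := by
    rw [bot_lt_iff_ne_bot, Ne, Ideal.span_singleton_eq_bot]
    exact X_ne_zero j
  have hlt2 : Ideal.span {(X j : MvPolynomial (Fin n) ℂ)} < p := by
    refine lt_of_le_of_ne ((Ideal.span_singleton_le_iff_mem _).mpr hjp) ?_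
    intro e
    rw [← e, Ideal.mem_span_singleton, X_dvd_X] at hkp
    exact hkj hkp.symm
  have e1 := Ideal.height_add_one_le_of_lt_of_isPrime hlt1
  have e2 := Ideal.height_add_one_le_of_lt_of_isPrime hlt2
  rw [Ideal.height_bot, zero_add] at e1
  calc (2 : ℕ∞) = 1 + 1 := by norm_num
    _ ≤ _ := add_le_add_left e1 1
    _ ≤ _ := e2

/-- For `f = Π_{i ∈ S} x_i` with `|S| ≥ 2`, the Jacobian ideal — which is
generated by the squarefree monomials `Π_{j ∈ S, j ≠ i} x_j` — is a radical
ideal of height `2`. -/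
theorem jacobian_ideal_of_normal_crossing_radical_height_two {n : ℕ}
    (S : Finset (Fin n)) (hS : 2 ≤ S.card)
    (f : MvPolynomial (Fin n) ℂ) (hf : f = ∏ i ∈ S, X i) :
    jacobianIdeal f =
        Ideal.span {g | ∃ i ∈ S, g = ∏ j ∈ S.erase i, X j} ∧
      (jacobianIdeal f).IsRadical ∧
      idealHeight (jacobianIdeal f) = 2 := by
  subst hf
  rw [aux_jac]
  refine ⟨rfl, ?_, ?_⟩
  · intro x hx
    apply aux_mem S hS
    intro i hi j hj hij
    have hP := aux_isPrime ({i, j} : Set (Fin n))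
    obtain ⟨k, hk⟩ := hx
    exact hP.mem_of_pow_mem k (aux_le S hi hj hij hk)
  · apply le_antisymm
    · obtain ⟨i, hi, j, hj, hij⟩ := Finset.one_lt_card.mp (by omega : 1 < S.card)
      have hP := aux_isPrime ({i, j} : Set (Fin n))
      let P : PrimeSpectrum (MvPolynomial (Fin n) ℂ) := ⟨_, hP⟩
      refine le_trans (b := Order.height P) (sInf_le ⟨P, aux_le S hi hj hij, rfl⟩) ?_
      rw [← PrimeSpectrum.height_eq_orderHeight]
      have hm : Ideal.span (X '' {i, j} : Set (MvPolynomial (Fin n) ℂ)) ∈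
          (Ideal.span (X '' {i, j} : Set (MvPolynomial (Fin n) ℂ))).minimalPrimes := by
        rw [Ideal.minimalPrimes_eq_subsingleton_self]
        rfl
      have hfin : (X '' {i, j} : Set (MvPolynomial (Fin n) ℂ)).Finite := Set.toFinite _
      refine (Ideal.height_le_card_of_mem_minimalPrimes_span hfin hm).trans ?_
      have h2 : (X '' {i, j} : Set (MvPolynomial (Fin n) ℂ)).ncard ≤ 2 :=
        (Set.ncard_image_le (Set.toFinite _)).trans (Set.ncard_pair hij).le
      exact_mod_cast h2
    · apply le_sInf
      rintro _ ⟨p, hp, rfl⟩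
      rw [← PrimeSpectrum.height_eq_orderHeight]
      exact aux_two_le S hS p.asIdeal hp
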